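/- arXiv:2501.14027 — 5 statements merged into one kernel-verified Lean document; each statement's English description precedes it below -/
import Mathlib

section
/- (Classical Finner inequality for graphs.) Let ι be a finite set of sources and J a finite set of parties, with neighborhoods N_j ⊆ ι such that every source i belongs to N_j for at most two parties j. Let each source i carry a finite set X_i and probability weights μ_i : X_i → [0,1] with ∑_{x∈X_i} μ_i(x) = 1, and let sources be independent, so a configuration s ∈ ∏_i X_i has probability ∏_i μ_i(s_i). For each party j, let f_j : ∏_i X_i → ℝ depend only on the coordinates (s_i)_{i∈N_j}. Then E[∏_{j∈J} |f_j|] ≤ ∏_{j∈J} √(E[f_j²]), where E denotes expectation with respect to the product distribution. -/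
open Finset

/-- Weighted Cauchy–Schwarz inequality for a finite sum with nonnegative weights. -/
theorem sum_mul_abs_mul_abs_le_sqrt_mul_sqrt {Y : Type*} [Fintype Y] {p : Y → ℝ}
    (hp : ∀ y, 0 ≤ p y) (F G : Y → ℝ) :
    ∑ y, p y * (|F y| * |G y|) ≤ √(∑ y, p y * F y ^ 2) * √(∑ y, p y * G y ^ 2) := by
  refine le_trans (le_of_eq (sum_congr rfl fun y _ => ?_))
    (Real.sum_sqrt_mul_sqrt_le univ (f := fun y => p y * F y ^ 2) (g := fun y => p y * G y ^ 2)
      (fun y => mul_nonneg (hp y) (sq_nonneg _)) (fun y => mul_nonneg (hp y) (sq_nonneg _)))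
  rw [Real.sqrt_mul (hp y), Real.sqrt_mul (hp y), Real.sqrt_sq_eq_abs, Real.sqrt_sq_eq_abs,
    mul_mul_mul_comm, Real.mul_self_sqrt (hp y)]

/-- If at most two factors of a product are non-constant, its expectation is at most the product
of the `L²` norms of its factors. -/
theorem sum_mul_prod_abs_le_prod_sqrt {J Y : Type*} [Fintype J] [Fintype Y] {p : Y → ℝ}
    (hp : ∀ y, 0 ≤ p y) (hp1 : ∑ y, p y = 1) (F : J → Y → ℝ) (D : Finset J) (hD : #D ≤ 2)
    (hF : ∀ j ∉ D, ∀ y y', F j y = F j y') :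
    ∑ y, p y * ∏ j, |F j y| ≤ ∏ j, √(∑ y, p y * F j y ^ 2) := by
  classical
  have hY : Nonempty Y := by
    by_contra h
    rw [not_nonempty_iff] at h
    simp at hp1
  obtain ⟨y₀⟩ := hY
  have hconst : ∀ j ∈ Dᶜ, √(∑ y, p y * F j y ^ 2) = |F j y₀| := fun j hj => by
    simp_rw [hF j (mem_compl.mp hj) _ y₀, ← sum_mul, hp1, one_mul, Real.sqrt_sq_eq_abs]
  have hsplit : ∀ y, p y * ∏ j, |F j y| = (p y * ∏ j ∈ D, |F j y|) * ∏ j ∈ Dᶜ, |F j y₀| :=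
    fun y => by
      rw [← prod_mul_prod_compl D, mul_assoc]
      congr 2
      exact prod_congr rfl fun j hj => by rw [hF j (mem_compl.mp hj) y y₀]
  rw [sum_congr rfl fun y _ => hsplit y, ← sum_mul, ← prod_mul_prod_compl D,
    prod_congr rfl hconst]
  refine mul_le_mul_of_nonneg_right ?_ (prod_nonneg fun _ _ => abs_nonneg _)
  have hcard : #D = 0 ∨ #D = 1 ∨ #D = 2 := by omega
  rcases hcard with h | h | h
  · simp [card_eq_zero.mp h, hp1]
  · obtain ⟨a, rfl⟩ := card_eq_one.mp h
    simpa [hp1] using sum_mul_abs_mul_abs_le_sqrt_mul_sqrt hp (F a) 1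
  · obtain ⟨a, b, hab, rfl⟩ := card_eq_two.mp h
    simpa [prod_pair hab] using sum_mul_abs_mul_abs_le_sqrt_mul_sqrt hp (F a) (F b)

/-- Resampling one coordinate does not change the expectation under a product distribution. -/
theorem sum_prod_mul_sum_update {ι : Type*} [Fintype ι] [DecidableEq ι] {X : ι → Type*}
    [∀ i, Fintype (X i)] (μ : ∀ i, X i → ℝ) (i : ι) (hμ1 : ∑ x, μ i x = 1)
    (g : (∀ i, X i) → ℝ) :
    ∑ s : ∀ i, X i, (∏ k, μ k (s k)) * ∑ x, μ i x * g (Function.update s i x)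
      = ∑ s : ∀ i, X i, (∏ k, μ k (s k)) * g s := by
  let swap : (∀ i, X i) × X i → (∀ i, X i) × X i := fun q => (Function.update q.1 i q.2, q.1 i)
  have hswap : Function.Involutive swap := fun q => by simp [swap]
  have hweight : ∀ (s : ∀ i, X i) (x : X i),
      (∏ k, μ k (s k)) * μ i x = (∏ k, μ k (Function.update s i x k)) * μ i (s i) := by
    intro s x
    rw [← mul_prod_erase univ _ (mem_univ i),
      ← mul_prod_erase univ (fun k => μ k (Function.update s i x k)) (mem_univ i),
      Function.update_self, prod_congr rfl fun k hk => by
        rw [← Function.update_of_ne (ne_of_mem_erase hk) x s]]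
    ring
  calc ∑ s : ∀ i, X i, (∏ k, μ k (s k)) * ∑ x, μ i x * g (Function.update s i x)
      = ∑ q : (∀ i, X i) × X i,
          (∏ k, μ k (q.1 k)) * μ i q.2 * g (Function.update q.1 i q.2) := by
        simp_rw [Fintype.sum_prod_type, mul_sum, mul_assoc]
    _ = ∑ q : (∀ i, X i) × X i, (∏ k, μ k (q.1 k)) * μ i q.2 * g q.1 :=
        Fintype.sum_equiv (hswap.toPerm swap) _ _ fun q => by
          rw [hweight]
          rfl
    _ = ∑ s : ∀ i, X i, (∏ k, μ k (s k)) * g s := by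
        simp_rw [Fintype.sum_prod_type, ← sum_mul, ← mul_sum, hμ1, mul_one]

/-- Finner's inequality for graphs when all neighborhoods lie in a given set `S` of sources. -/
theorem finner_graph_of_subset {ι J : Type*} [Fintype ι] [DecidableEq ι] [Fintype J]
    {X : ι → Type*} [∀ i, Fintype (X i)] [∀ i, Nonempty (X i)]
    (μ : ∀ i, X i → ℝ) (hμ0 : ∀ i x, 0 ≤ μ i x) (hμ1 : ∀ i, ∑ x, μ i x = 1) (S : Finset ι)
    (N : J → Finset ι) (hN : ∀ j, N j ⊆ S) (hdeg : ∀ i, #{j | i ∈ N j} ≤ 2)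
    (f : J → (∀ i, X i) → ℝ)
    (hloc : ∀ j, ∀ s s' : ∀ i, X i, (∀ i ∈ N j, s i = s' i) → f j s = f j s') :
    ∑ s : ∀ i, X i, (∏ i, μ i (s i)) * ∏ j, |f j s|
      ≤ ∏ j, √(∑ s : ∀ i, X i, (∏ i, μ i (s i)) * f j s ^ 2) := by
  have hw : ∀ s : ∀ i, X i, 0 ≤ ∏ i, μ i (s i) := fun s => prod_nonneg fun i _ => hμ0 i _
  induction S using Finset.induction_on generalizing N f with
  | empty =>
    have hw1 : ∑ s : ∀ i, X i, ∏ i, μ i (s i) = 1 := by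
      rw [← Fintype.prod_sum]
      simp [hμ1]
    refine sum_mul_prod_abs_le_prod_sqrt hw hw1 f ∅ (by simp) fun j _ s s' => hloc j s s' ?_
    intro i hi
    exact absurd (hN j hi) (notMem_empty i)
  | insert i T _ ih =>
    let f' : J → (∀ i, X i) → ℝ := fun j s => √(∑ x, μ i x * f j (Function.update s i x) ^ 2)
    have hf' : ∀ j s, f' j s ^ 2 = ∑ x, μ i x * f j (Function.update s i x) ^ 2 := fun j s =>
      Real.sq_sqrt (sum_nonneg fun x _ => mul_nonneg (hμ0 i x) (sq_nonneg _))
    have key := ih (fun j => (N j).erase i)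
      (fun j => (erase_subset_erase i (hN j)).trans (erase_insert_subset i T))
      (fun k => (card_le_card (monotone_filter_right _ fun j _ hj => mem_of_mem_erase hj)).trans
        (hdeg k)) f' (fun j s s' h => by
          refine congrArg Real.sqrt (sum_congr rfl fun x _ => ?_)
          rw [hloc j (Function.update s i x) (Function.update s' i x) fun k hk => ?_]
          by_cases hki : k = i
          · subst hki
            simp
          · simpa [hki] using h k (mem_erase.mpr ⟨hki, hk⟩))
    have hnorm : ∀ j, ∑ s : ∀ i, X i, (∏ i, μ i (s i)) * f' j s ^ 2
        = ∑ s : ∀ i, X i, (∏ i, μ i (s i)) * f j s ^ 2 := fun j => by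
      simp_rw [hf']
      exact sum_prod_mul_sum_update μ i (hμ1 i) fun s => f j s ^ 2
    simp_rw [hnorm] at key
    refine le_trans ?_ key
    rw [← sum_prod_mul_sum_update μ i (hμ1 i) fun s => ∏ j, |f j s|]
    refine sum_le_sum fun s _ => mul_le_mul_of_nonneg_left ?_ (hw s)
    simp_rw [f', abs_of_nonneg (Real.sqrt_nonneg _)]
    refine sum_mul_prod_abs_le_prod_sqrt (hμ0 i) (hμ1 i)
      (fun j x => f j (Function.update s i x)) {j | i ∈ N j} (hdeg i) fun j hj x x' => ?_
    refine hloc j _ _ fun k hk => ?_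
    have hki : k ≠ i := by
      rintro rfl
      exact hj (by simpa using hk)
    simp [hki]


/-- Classical Finner inequality for graphs: sources `ι`, parties `J` with
neighborhoods `N j`, every source connected to at most two parties, independent
sources with distributions `μ i`, and functions `f j` local to the parties.
Then `E[∏ j |f j|] ≤ ∏ j √(E[(f j)²])`. -/
theorem classical_finner_graph {ι J : Type} [Fintype ι] [DecidableEq ι] [Fintype J]
    {X : ι → Type} [∀ i, Fintype (X i)] [∀ i, Nonempty (X i)]
    (N : J → Finset ι)
    (hdeg : ∀ i, (Finset.univ.filter (fun j => i ∈ N j)).card ≤ 2)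
    (μ : ∀ i, X i → ℝ) (hμ0 : ∀ i x, 0 ≤ μ i x) (hμ1 : ∀ i, ∑ x, μ i x = 1)
    (f : J → (∀ i, X i) → ℝ)
    (hloc : ∀ j, ∀ s s' : ∀ i, X i, (∀ i ∈ N j, s i = s' i) → f j s = f j s') :
    ∑ s : ∀ i, X i, (∏ i, μ i (s i)) * ∏ j, |f j s|
      ≤ ∏ j, Real.sqrt (∑ s : ∀ i, X i, (∏ i, μ i (s i)) * (f j s) ^ 2) := by
  exact finner_graph_of_subset μ hμ0 hμ1 univ N (fun _ => subset_univ _) hdeg f hloc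
end

section
/- (General classical Finner inequality.) Let ι be a finite set of sources and J a finite set of parties, with neighborhoods N_j ⊆ ι. Let each source i carry a finite set X_i and probability weights μ_i : X_i → [0,1] summing to 1, with sources independent. Let x_j ∈ (0,1] for j ∈ J be a fractional independent set, i.e., for every source i, ∑_{j : i ∈ N_j} x_j ≤ 1. For each party j let f_j : ∏_i X_i → ℝ depend only on the coordinates (s_i)_{i∈N_j}. Then E[∏_{j∈J} |f_j|] ≤ ∏_{j∈J} (E[|f_j|^{1/x_j}])^{x_j}. -/
open Finset

/-- Weighted AM-GM with weights of total mass at most one. -/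
theorem prod_rpow_le_one_sub_add_sum {J : Type*} (T : Finset J) (x z : J → ℝ)
    (hx : ∀ j ∈ T, 0 ≤ x j) (hsum : ∑ j ∈ T, x j ≤ 1) (hz : ∀ j ∈ T, 0 ≤ z j) :
    ∏ j ∈ T, z j ^ x j ≤ (1 - ∑ j ∈ T, x j) + ∑ j ∈ T, x j * z j := by
  have h := Real.geom_mean_le_arith_mean_weighted (insertNone T)
    (fun o => o.elim (1 - ∑ j ∈ T, x j) x) (fun o => o.elim 1 z)
    (by rintro (_ | j) hj
        · simpa using hsum
        · exact hx j (by simpa using hj))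
    (by simp [sum_insertNone])
    (by rintro (_ | j) hj
        · simp
        · exact hz j (by simpa using hj))
  simpa [sum_insertNone, prod_insertNone] using h

/-- Hölder's inequality for a finite probability space and exponents whose reciprocals sum to
at most one. -/
theorem sum_weight_mul_prod_rpow_le {J α : Type*} [Fintype α] (T : Finset J) (x : J → ℝ)
    (hx : ∀ j ∈ T, 0 < x j) (hsum : ∑ j ∈ T, x j ≤ 1)
    (w : α → ℝ) (hw : ∀ a, 0 ≤ w a) (hw1 : ∑ a, w a = 1)
    (g : J → α → ℝ) (hg : ∀ j ∈ T, ∀ a, 0 ≤ g j a) :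
    ∑ a, w a * ∏ j ∈ T, g j a ^ x j ≤ ∏ j ∈ T, (∑ a, w a * g j a) ^ x j := by
  have hG : ∀ j ∈ T, 0 ≤ ∑ a, w a * g j a := fun j hj =>
    sum_nonneg fun a _ => mul_nonneg (hw a) (hg j hj a)
  by_cases hpos : ∀ j ∈ T, 0 < ∑ a, w a * g j a
  · have hfac : ∀ a, ∏ j ∈ T, g j a ^ x j =
        (∏ j ∈ T, (∑ b, w b * g j b) ^ x j) *
          ∏ j ∈ T, (g j a / ∑ b, w b * g j b) ^ x j := by
      intro a
      rw [← prod_mul_distrib]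
      refine prod_congr rfl fun j hj => ?_
      rw [← Real.mul_rpow (hG j hj) (div_nonneg (hg j hj a) (hG j hj)),
        mul_div_cancel₀ _ (hpos j hj).ne']
    have hnorm : ∑ a, w a * ∏ j ∈ T, (g j a / ∑ b, w b * g j b) ^ x j ≤ 1 := by
      calc ∑ a, w a * ∏ j ∈ T, (g j a / ∑ b, w b * g j b) ^ x j
          ≤ ∑ a, w a * ((1 - ∑ j ∈ T, x j) +
              ∑ j ∈ T, x j * (g j a / ∑ b, w b * g j b)) :=
            sum_le_sum fun a _ => mul_le_mul_of_nonneg_left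
              (prod_rpow_le_one_sub_add_sum T x _ (fun j hj => (hx j hj).le) hsum
                fun j hj => div_nonneg (hg j hj a) (hG j hj)) (hw a)
        _ = (1 - ∑ j ∈ T, x j) +
              ∑ j ∈ T, x j * ((∑ a, w a * g j a) / ∑ b, w b * g j b) := by
            simp_rw [mul_add, sum_add_distrib, ← sum_mul, hw1, one_mul, mul_sum]
            rw [sum_comm]
            congr 1
            refine sum_congr rfl fun j _ => ?_
            rw [sum_div, mul_sum]
            exact sum_congr rfl fun a _ => by ring
        _ = 1 := by
            have hself : ∑ j ∈ T, x j * ((∑ a, w a * g j a) / ∑ b, w b * g j b) =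
                ∑ j ∈ T, x j :=
              sum_congr rfl fun j hj => by rw [div_self (hpos j hj).ne', mul_one]
            rw [hself, sub_add_cancel]
    simp_rw [hfac, mul_left_comm (w _), ← mul_sum]
    exact mul_le_of_le_one_right (prod_nonneg fun j hj => Real.rpow_nonneg (hG j hj) _) hnorm
  · push Not at hpos
    obtain ⟨k, hk, hk0⟩ := hpos
    have hzero : ∀ a, w a * g k a = 0 := fun a =>
      (sum_eq_zero_iff_of_nonneg fun a _ => mul_nonneg (hw a) (hg k hk a)).1
        (le_antisymm hk0 (hG k hk)) a (mem_univ a)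
    refine le_trans (le_of_eq (sum_eq_zero fun a _ => ?_))
      (prod_nonneg fun j hj => Real.rpow_nonneg (hG j hj) _)
    rcases mul_eq_zero.1 (hzero a) with h | h
    · rw [h, zero_mul]
    · rw [prod_eq_zero hk (by rw [h, Real.zero_rpow (hx k hk).ne']), mul_zero]

section Finner

variable {ι : Type*} [DecidableEq ι] {X : ι → Type*} [∀ i, Fintype (X i)]

/-- Averaging a function over the coordinate `i`. -/
def coordAverage (μ : ∀ i, X i → ℝ) (i : ι) (g : (∀ i, X i) → ℝ) (s : ∀ i, X i) : ℝ :=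
  ∑ t, μ i t * g (Function.update s i t)

/-- Averaging each factor over one source does not decrease the product pointwise. -/
theorem coordAverage_prod_rpow_le {J : Type*} [Fintype J] (N : J → Finset ι)
    (x : J → ℝ) (hx : ∀ j, 0 < x j) (i : ι)
    (hfrac : ∑ j ∈ univ.filter (fun j => i ∈ N j), x j ≤ 1)
    (μ : ∀ i, X i → ℝ) (hμ0 : ∀ i t, 0 ≤ μ i t) (hμ1 : ∀ i, ∑ t, μ i t = 1)
    (g : J → (∀ i, X i) → ℝ) (hg : ∀ j s, 0 ≤ g j s)
    (hloc : ∀ j, i ∉ N j → ∀ s t, g j (Function.update s i t) = g j s) (s : ∀ i, X i) :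
    coordAverage μ i (fun s => ∏ j, g j s ^ x j) s ≤ ∏ j, coordAverage μ i (g j) s ^ x j := by
  have hconst : ∀ j ∈ univ.filter (fun j => i ∉ N j), coordAverage μ i (g j) s = g j s := by
    intro j hj
    simp_rw [coordAverage, hloc j (mem_filter.1 hj).2, ← sum_mul, hμ1, one_mul]
  have hout : ∀ t, ∏ j ∈ univ.filter (fun j => i ∉ N j), g j (Function.update s i t) ^ x j =
      ∏ j ∈ univ.filter (fun j => i ∉ N j), g j s ^ x j := fun t =>
    prod_congr rfl fun j hj => by rw [hloc j (mem_filter.1 hj).2]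
  rw [← prod_filter_mul_prod_filter_not univ (fun j => i ∈ N j),
    prod_congr (s₁ := univ.filter (fun j => i ∉ N j)) rfl fun j hj => by rw [hconst j hj]]
  simp_rw [coordAverage, ← prod_filter_mul_prod_filter_not univ (fun j => i ∈ N j), hout,
    ← mul_assoc, ← sum_mul]
  exact mul_le_mul_of_nonneg_right
    (sum_weight_mul_prod_rpow_le _ x (fun j _ => hx j) hfrac (μ i) (hμ0 i) (hμ1 i)
      (fun j t => g j (Function.update s i t)) fun j _ t => hg j _)
    (prod_nonneg fun j _ => Real.rpow_nonneg (hg j s) _)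

variable [Fintype ι]

theorem sum_prod_weight_eq_one (μ : ∀ i, X i → ℝ) (hμ1 : ∀ i, ∑ t, μ i t = 1) :
    ∑ s : ∀ i, X i, ∏ i, μ i (s i) = 1 := by
  rw [← Fintype.piFinset_univ, ← prod_univ_sum]
  exact prod_eq_one fun i _ => hμ1 i

/-- Resampling one coordinate preserves expectations. -/
theorem expectation_coordAverage (μ : ∀ i, X i → ℝ) (hμ1 : ∀ i, ∑ t, μ i t = 1) (i : ι)
    (g : (∀ i, X i) → ℝ) :
    ∑ s : ∀ i, X i, (∏ k, μ k (s k)) * coordAverage μ i g s =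
      ∑ s : ∀ i, X i, (∏ k, μ k (s k)) * g s := by
  have hinv : Function.Involutive
      (fun p : (∀ i, X i) × X i => (Function.update p.1 i p.2, p.1 i)) := by
    rintro ⟨s, t⟩
    simp
  calc ∑ s : ∀ i, X i, (∏ k, μ k (s k)) * coordAverage μ i g s
      = ∑ p : (∀ i, X i) × X i,
          (∏ k, μ k (p.1 k)) * μ i p.2 * g (Function.update p.1 i p.2) := by
        simp_rw [Fintype.sum_prod_type, coordAverage, mul_sum, mul_assoc]
    _ = ∑ p : (∀ i, X i) × X i, (∏ k, μ k (p.1 k)) * μ i p.2 * g p.1 := by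
        refine Fintype.sum_equiv hinv.toPerm _ _ ?_
        rintro ⟨s, t⟩
        have hne : ∏ k ∈ univ.erase i, μ k (Function.update s i t k) =
            ∏ k ∈ univ.erase i, μ k (s k) :=
          prod_congr rfl fun k hk => by rw [Function.update_of_ne (ne_of_mem_erase hk)]
        simp only [Function.Involutive.coe_toPerm]
        rw [← mul_prod_erase univ _ (mem_univ i),
          ← mul_prod_erase univ (fun k => μ k (Function.update s i t k)) (mem_univ i), hne,
          Function.update_self]
        ring
    _ = ∑ s : ∀ i, X i, (∏ k, μ k (s k)) * g s := by
        simp_rw [Fintype.sum_prod_type, mul_right_comm _ (μ i _), ← mul_sum, hμ1, mul_one]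

/-- Finner's inequality for nonnegative functions, by induction on the set `S` of sources on which
they depend. -/
theorem finner_of_nonneg {J : Type*} [Fintype J] [∀ i, Nonempty (X i)] (N : J → Finset ι)
    (x : J → ℝ) (hx : ∀ j, 0 < x j)
    (hfrac : ∀ i, ∑ j ∈ univ.filter (fun j => i ∈ N j), x j ≤ 1)
    (μ : ∀ i, X i → ℝ) (hμ0 : ∀ i t, 0 ≤ μ i t) (hμ1 : ∀ i, ∑ t, μ i t = 1)
    (S : Finset ι) (g : J → (∀ i, X i) → ℝ) (hg : ∀ j s, 0 ≤ g j s)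
    (hloc : ∀ j, ∀ s s' : ∀ i, X i, (∀ i ∈ N j, i ∈ S → s i = s' i) → g j s = g j s') :
    ∑ s : ∀ i, X i, (∏ i, μ i (s i)) * ∏ j, g j s ^ x j
      ≤ ∏ j, (∑ s : ∀ i, X i, (∏ i, μ i (s i)) * g j s) ^ x j := by
  induction S using Finset.induction_on generalizing g with
  | empty =>
    obtain ⟨s₀⟩ : Nonempty (∀ i, X i) := inferInstance
    have hconst : ∀ j s, g j s = g j s₀ := fun j s => hloc j s s₀ (by simp)
    simp_rw [hconst, ← sum_mul, sum_prod_weight_eq_one μ hμ1, one_mul]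
    exact le_rfl
  | insert i S _ ih =>
    have hstep : ∑ s : ∀ i, X i, (∏ i, μ i (s i)) * ∏ j, g j s ^ x j ≤
        ∑ s : ∀ i, X i, (∏ i, μ i (s i)) * ∏ j, coordAverage μ i (g j) s ^ x j := by
      rw [← expectation_coordAverage μ hμ1 i]
      refine sum_le_sum fun s _ => mul_le_mul_of_nonneg_left ?_
        (prod_nonneg fun k _ => hμ0 k _)
      refine coordAverage_prod_rpow_le N x hx i (hfrac i) μ hμ0 hμ1 g hg ?_ s
      refine fun j hij s t => hloc j _ _ fun k hk _ => ?_
      rw [Function.update_of_ne]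
      rintro rfl
      exact hij hk
    refine hstep.trans ((ih (fun j => coordAverage μ i (g j)) ?_ ?_).trans_eq ?_)
    · exact fun j s => sum_nonneg fun t _ => mul_nonneg (hμ0 i t) (hg j _)
    · refine fun j s s' h => sum_congr rfl fun t _ => ?_
      rw [hloc j (Function.update s i t) (Function.update s' i t)]
      intro k hk hkS
      rcases eq_or_ne k i with rfl | hki
      · simp
      · simpa [hki] using h k hk ((mem_insert.1 hkS).resolve_left hki)
    · simp_rw [expectation_coordAverage μ hμ1 i]

end Finner

/-- General classical Finner inequality: sources `ι`, parties `J` with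
neighborhoods `N j`, independent sources with distributions `μ i`, a fractional
independent set `x j ∈ (0,1]` (for every source the weights of the connected
parties sum to at most 1), and functions `f j` local to the parties.  Then
`E[∏ j |f j|] ≤ ∏ j (E[|f j|^(1/x j)])^(x j)`. -/
theorem classical_finner_general {ι J : Type} [Fintype ι] [DecidableEq ι] [Fintype J]
    {X : ι → Type} [∀ i, Fintype (X i)] [∀ i, Nonempty (X i)]
    (N : J → Finset ι)
    (x : J → ℝ) (hx : ∀ j, 0 < x j ∧ x j ≤ 1)
    (hfrac : ∀ i, ∑ j ∈ Finset.univ.filter (fun j => i ∈ N j), x j ≤ 1)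
    (μ : ∀ i, X i → ℝ) (hμ0 : ∀ i x, 0 ≤ μ i x) (hμ1 : ∀ i, ∑ x, μ i x = 1)
    (f : J → (∀ i, X i) → ℝ)
    (hloc : ∀ j, ∀ s s' : ∀ i, X i, (∀ i ∈ N j, s i = s' i) → f j s = f j s') :
    ∑ s : ∀ i, X i, (∏ i, μ i (s i)) * ∏ j, |f j s|
      ≤ ∏ j, (∑ s : ∀ i, X i, (∏ i, μ i (s i)) * |f j s| ^ (1 / x j)) ^ (x j) := by
  have h := finner_of_nonneg N x (fun j => (hx j).1) hfrac μ hμ0 hμ1 univ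
    (fun j s => |f j s| ^ (1 / x j)) (fun j s => Real.rpow_nonneg (abs_nonneg _) _)
    (fun j s s' hs => by rw [hloc j s s' fun i hi => hs i hi (mem_univ i)])
  have hroot : ∀ j s, (|f j s| ^ (1 / x j)) ^ x j = |f j s| := fun j s => by
    rw [← Real.rpow_mul (abs_nonneg _), one_div_mul_cancel (hx j).1.ne', Real.rpow_one]
  simpa only [hroot] using h
end

section
/- (Quantum Finner inequality for one bipartite source.) Let ψ be a unit vector in ℂ^{d_A} ⊗ ℂ^{d_B}, and let A be Hermitian on ℂ^{d_A} with 0 ⪯ A ⪯ 1 and B Hermitian on ℂ^{d_B} with 0 ⪯ B ⪯ 1. Then ⟨ψ, (A ⊗ B)ψ⟩ ≤ √( ⟨ψ, (A ⊗ 1)ψ⟩ · ⟨ψ, (1 ⊗ B)ψ⟩ ), where all three inner products are real (they are expectation values of Hermitian operators) and lie in [0,1]. -/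
open Matrix Kronecker ComplexOrder

section QuadraticForm

variable {n : Type*} [Fintype n]

/-- The quadratic form of a positive semidefinite matrix is real and nonnegative. -/
lemma Matrix.PosSemidef.im_eq_zero_and_re_nonneg {M : Matrix n n ℂ} (hM : M.PosSemidef)
    (x : n → ℂ) : (star x ⬝ᵥ (M *ᵥ x)).im = 0 ∧ 0 ≤ (star x ⬝ᵥ (M *ᵥ x)).re := by
  have h := Complex.le_def.mp (hM.dotProduct_mulVec_nonneg x)
  exact ⟨h.2.symm, h.1⟩

/-- The quadratic form is monotone in the Loewner order. -/
lemma Matrix.PosSemidef.re_dotProduct_mulVec_le {M N : Matrix n n ℂ} (h : (N - M).PosSemidef)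
    (x : n → ℂ) : (star x ⬝ᵥ (M *ᵥ x)).re ≤ (star x ⬝ᵥ (N *ᵥ x)).re := by
  have := (h.im_eq_zero_and_re_nonneg x).2
  rw [sub_mulVec, dotProduct_sub, Complex.sub_re] at this
  linarith

end QuadraticForm

section KroneckerSub

variable {R l m n p : Type*} [NonUnitalNonAssocRing R]

lemma Matrix.kronecker_sub (A : Matrix l m R) (B C : Matrix n p R) :
    A ⊗ₖ (B - C) = A ⊗ₖ B - A ⊗ₖ C := by
  ext
  exact mul_sub _ _ _

lemma Matrix.sub_kronecker (A B : Matrix l m R) (C : Matrix n p R) :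
    (A - B) ⊗ₖ C = A ⊗ₖ C - B ⊗ₖ C := by
  ext
  exact sub_mul _ _ _

end KroneckerSub

/-- Quantum Finner inequality for one bipartite source: for a unit vector `ψ`
and Hermitian `A, B` with `0 ⪯ A ⪯ 1`, `0 ⪯ B ⪯ 1`, the three expectation
values `⟨ψ,(A⊗B)ψ⟩`, `⟨ψ,(A⊗1)ψ⟩`, `⟨ψ,(1⊗B)ψ⟩` are real and lie in `[0,1]`,
and `⟨ψ,(A⊗B)ψ⟩ ≤ √(⟨ψ,(A⊗1)ψ⟩ · ⟨ψ,(1⊗B)ψ⟩)`. -/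
theorem quantum_finner_one_source {dA dB : ℕ}
    (ψ : Fin dA × Fin dB → ℂ) (hψ : star ψ ⬝ᵥ ψ = 1)
    (A : Matrix (Fin dA) (Fin dA) ℂ) (hA : A.PosSemidef)
    (hA1 : ((1 : Matrix (Fin dA) (Fin dA) ℂ) - A).PosSemidef)
    (B : Matrix (Fin dB) (Fin dB) ℂ) (hB : B.PosSemidef)
    (hB1 : ((1 : Matrix (Fin dB) (Fin dB) ℂ) - B).PosSemidef) :
    ((star ψ ⬝ᵥ ((A ⊗ₖ B) *ᵥ ψ)).im = 0 ∧
      0 ≤ (star ψ ⬝ᵥ ((A ⊗ₖ B) *ᵥ ψ)).re ∧ (star ψ ⬝ᵥ ((A ⊗ₖ B) *ᵥ ψ)).re ≤ 1)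
    ∧ ((star ψ ⬝ᵥ ((A ⊗ₖ (1 : Matrix (Fin dB) (Fin dB) ℂ)) *ᵥ ψ)).im = 0 ∧
      0 ≤ (star ψ ⬝ᵥ ((A ⊗ₖ (1 : Matrix (Fin dB) (Fin dB) ℂ)) *ᵥ ψ)).re ∧
      (star ψ ⬝ᵥ ((A ⊗ₖ (1 : Matrix (Fin dB) (Fin dB) ℂ)) *ᵥ ψ)).re ≤ 1)
    ∧ ((star ψ ⬝ᵥ (((1 : Matrix (Fin dA) (Fin dA) ℂ) ⊗ₖ B) *ᵥ ψ)).im = 0 ∧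
      0 ≤ (star ψ ⬝ᵥ (((1 : Matrix (Fin dA) (Fin dA) ℂ) ⊗ₖ B) *ᵥ ψ)).re ∧
      (star ψ ⬝ᵥ (((1 : Matrix (Fin dA) (Fin dA) ℂ) ⊗ₖ B) *ᵥ ψ)).re ≤ 1)
    ∧ (star ψ ⬝ᵥ ((A ⊗ₖ B) *ᵥ ψ)).re
        ≤ Real.sqrt ((star ψ ⬝ᵥ ((A ⊗ₖ (1 : Matrix (Fin dB) (Fin dB) ℂ)) *ᵥ ψ)).re *
            (star ψ ⬝ᵥ (((1 : Matrix (Fin dA) (Fin dA) ℂ) ⊗ₖ B) *ᵥ ψ)).re) := by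
  have hAB := (hA.kronecker hB).im_eq_zero_and_re_nonneg ψ
  have hA' := (hA.kronecker (PosSemidef.one (n := Fin dB))).im_eq_zero_and_re_nonneg ψ
  have hB' := ((PosSemidef.one (n := Fin dA)).kronecker hB).im_eq_zero_and_re_nonneg ψ
  have hone : (star ψ ⬝ᵥ ((1 : Matrix (Fin dA × Fin dB) (Fin dA × Fin dB) ℂ) *ᵥ ψ)).re = 1 := by
    rw [one_mulVec, hψ, Complex.one_re]
  have hABA : (A ⊗ₖ (1 : Matrix (Fin dB) (Fin dB) ℂ) - A ⊗ₖ B).PosSemidef := by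
    rw [← kronecker_sub]
    exact hA.kronecker hB1
  have hABB : ((1 : Matrix (Fin dA) (Fin dA) ℂ) ⊗ₖ B - A ⊗ₖ B).PosSemidef := by
    rw [← sub_kronecker]
    exact hA1.kronecker hB
  have hAone : (1 - A ⊗ₖ (1 : Matrix (Fin dB) (Fin dB) ℂ)).PosSemidef := by
    rw [← one_kronecker_one, ← sub_kronecker]
    exact hA1.kronecker PosSemidef.one
  have hBone : (1 - (1 : Matrix (Fin dA) (Fin dA) ℂ) ⊗ₖ B).PosSemidef := by
    rw [← one_kronecker_one, ← kronecker_sub]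
    exact PosSemidef.one.kronecker hB1
  have leA := hABA.re_dotProduct_mulVec_le ψ
  have leB := hABB.re_dotProduct_mulVec_le ψ
  have leA1 := (hAone.re_dotProduct_mulVec_le ψ).trans_eq hone
  have leB1 := (hBone.re_dotProduct_mulVec_le ψ).trans_eq hone
  refine ⟨⟨hAB.1, hAB.2, leA.trans leA1⟩, ⟨hA'.1, hA'.2, leA1⟩, ⟨hB'.1, hB'.2, leB1⟩, ?_⟩
  apply Real.le_sqrt_of_sq_le
  rw [sq]
  exact mul_le_mul leA leB hAB.2 hA'.2
end

section
/- (Quantum Finner rigidity for one bipartite source.) Let ψ be a unit vector in ℂ^{d_A} ⊗ ℂ^{d_B}, and let A be Hermitian on ℂ^{d_A} with 0 ⪯ A ⪯ 1 and B Hermitian on ℂ^{d_B} with 0 ⪯ B ⪯ 1. Assume ⟨ψ, (A ⊗ B)ψ⟩ > 0. Then equality ⟨ψ, (A ⊗ B)ψ⟩ = √( ⟨ψ, (A ⊗ 1)ψ⟩ · ⟨ψ, (1 ⊗ B)ψ⟩ ) holds if and only if there exist a finite index set L, orthonormal families (u_ℓ)_{ℓ∈L} in ℂ^{d_A} and (v_ℓ)_{ℓ∈L}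 in ℂ^{d_B}, positive reals (λ_ℓ)_{ℓ∈L} with ∑_ℓ λ_ℓ² = 1, and a function χ : L → {0,1}, such that ψ = ∑_{ℓ∈L} λ_ℓ · u_ℓ ⊗ v_ℓ and, for all ℓ, ℓ' ∈ L, ⟨u_ℓ, A u_{ℓ'}⟩ = χ(ℓ)·δ_{ℓ,ℓ'} and ⟨v_ℓ, B v_{ℓ'}⟩ = χ(ℓ)·δ_{ℓ,ℓ'}. That is, the Finner inequality is saturated exactly when both measurement operators act, on the support of the state, as the same diagonal 0/1-projector in a Schmidt basis of ψ. -/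
open Matrix Kronecker ComplexOrder

section Saturation

variable {n : Type*} [Fintype n] {X Y : Matrix n n ℂ}

lemma Matrix.PosSemidef.sub_mul_self [DecidableEq n] (hX : X.PosSemidef) (hX1 : (1 - X).PosSemidef) :
    (X - X * X).PosSemidef := by
  have h := (hX1.conjTranspose_mul_mul_same X).add (hX.conjTranspose_mul_mul_same (1 - X))
  rw [hX.1.eq, hX1.1.eq] at h
  convert h using 1
  noncomm_ring

lemma Matrix.IsHermitian.star_mulVec_dotProduct (hX : X.IsHermitian) (x y : n → ℂ) :
    star (X *ᵥ x) ⬝ᵥ y = star x ⬝ᵥ (X *ᵥ y) := by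
  rw [star_mulVec, hX.eq, dotProduct_mulVec]

/-- Eigenvectors of a Hermitian matrix for distinct eigenvalues are orthogonal. -/
lemma Matrix.IsHermitian.star_dotProduct_eq_zero (hX : X.IsHermitian) {x y : n → ℂ} {c d : ℂ}
    (hx : X *ᵥ x = c • x) (hy : X *ᵥ y = d • y) (hcd : star c ≠ d) : star x ⬝ᵥ y = 0 := by
  have h := hX.star_mulVec_dotProduct x y
  rw [hx, hy, star_smul, smul_dotProduct, dotProduct_smul, smul_eq_mul, smul_eq_mul] at h
  exact (mul_eq_mul_right_iff.1 h).resolve_left hcd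

lemma Complex.exists_ofReal_of_nonneg {z : ℂ} (hz : 0 ≤ z) : ∃ r : ℝ, 0 ≤ r ∧ z = r :=
  ⟨z.re, (Complex.nonneg_iff.1 hz).1, Complex.ext rfl (Complex.nonneg_iff.1 hz).2.symm⟩

/-- Saturation of the Cauchy–Schwarz bound for commuting effects forces them to act on the
state as one and the same projection. -/
lemma mulVec_eq_of_saturation [DecidableEq n] (hX : X.PosSemidef) (hX1 : (1 - X).PosSemidef)
    (hY : Y.PosSemidef) (hY1 : (1 - Y).PosSemidef) (hXY : X * Y = Y * X) (ψ : n → ℂ)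
    (hpos : 0 < star ψ ⬝ᵥ ((X * Y) *ᵥ ψ))
    (heq : (star ψ ⬝ᵥ ((X * Y) *ᵥ ψ)).re =
      Real.sqrt ((star ψ ⬝ᵥ (X *ᵥ ψ)).re * (star ψ ⬝ᵥ (Y *ᵥ ψ)).re)) :
    X *ᵥ ψ = Y *ᵥ ψ ∧ X *ᵥ (X *ᵥ ψ) = X *ᵥ ψ := by
  obtain ⟨x, hx0, hx⟩ := Complex.exists_ofReal_of_nonneg (hX.dotProduct_mulVec_nonneg ψ)
  obtain ⟨y, hy0, hy⟩ := Complex.exists_ofReal_of_nonneg (hY.dotProduct_mulVec_nonneg ψ)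
  obtain ⟨z, hz0, hz⟩ := Complex.exists_ofReal_of_nonneg hpos.le
  obtain ⟨p, hp0, hp⟩ := Complex.exists_ofReal_of_nonneg
    ((hX.sub_mul_self hX1).dotProduct_mulVec_nonneg ψ)
  obtain ⟨q, hq0, hq⟩ := Complex.exists_ofReal_of_nonneg
    ((hY.sub_mul_self hY1).dotProduct_mulVec_nonneg ψ)
  obtain ⟨s, hs0, hs⟩ := Complex.exists_ofReal_of_nonneg
    (dotProduct_star_self_nonneg ((y : ℂ) • (X *ᵥ ψ) - (z : ℂ) • (Y *ᵥ ψ)))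
  have hzpos : 0 < z := by rw [hz] at hpos; exact_mod_cast hpos
  have hzz : z * z = x * y := by
    rw [hx, hy, hz] at heq
    simp only [Complex.ofReal_re] at heq
    rw [heq, Real.mul_self_sqrt (mul_nonneg hx0 hy0)]
  have hypos : 0 < y := by
    rcases hy0.eq_or_lt with h | h
    · rw [← h] at hzz; nlinarith
    · exact h
  have hYX : star ψ ⬝ᵥ (Y *ᵥ (X *ᵥ ψ)) = z := by rw [mulVec_mulVec, ← hXY, hz]
  rw [← mulVec_mulVec] at hz
  rw [sub_mulVec, dotProduct_sub, hx, ← mulVec_mulVec] at hp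
  rw [sub_mulVec, dotProduct_sub, hy, ← mulVec_mulVec] at hq
  have hsum : s + y ^ 2 * p + z ^ 2 * q = 0 := by
    have : (s : ℂ) + y ^ 2 * p + z ^ 2 * q = y * (x * y - z * z) := by
      rw [← hs, ← hp, ← hq]
      simp only [star_sub, star_smul, sub_dotProduct, dotProduct_sub, smul_dotProduct,
        dotProduct_smul, hX.1.star_mulVec_dotProduct, hY.1.star_mulVec_dotProduct, hYX, hz,
        Complex.star_def, Complex.conj_ofReal, smul_eq_mul]
      ring
    have h0 : (x : ℂ) * y - z * z = 0 := by rw [sub_eq_zero]; exact_mod_cast hzz.symm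
    rw [h0, mul_zero] at this
    exact_mod_cast this
  have hyp : 0 ≤ y ^ 2 * p := by positivity
  have hzq : 0 ≤ z ^ 2 * q := by positivity
  have hs' : s = 0 := by linarith
  have hp' : p = 0 := (mul_eq_zero.1 (by linarith : y ^ 2 * p = 0)).resolve_left (by positivity)
  have hq' : q = 0 := (mul_eq_zero.1 (by linarith : z ^ 2 * q = 0)).resolve_left (by positivity)
  have hXX : X *ᵥ (X *ᵥ ψ) = X *ᵥ ψ := by
    have := (hX.sub_mul_self hX1).dotProduct_mulVec_zero_iff ψ |>.1 (by
      rw [sub_mulVec, dotProduct_sub, hx, ← mulVec_mulVec, hp, hp', Complex.ofReal_zero])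
    rw [sub_mulVec, ← mulVec_mulVec, sub_eq_zero] at this
    exact this.symm
  have hYY : Y *ᵥ (Y *ᵥ ψ) = Y *ᵥ ψ := by
    have := (hY.sub_mul_self hY1).dotProduct_mulVec_zero_iff ψ |>.1 (by
      rw [sub_mulVec, dotProduct_sub, hy, ← mulVec_mulVec, hq, hq', Complex.ofReal_zero])
    rw [sub_mulVec, ← mulVec_mulVec, sub_eq_zero] at this
    exact this.symm
  have hprop : (y : ℂ) • (X *ᵥ ψ) = (z : ℂ) • (Y *ᵥ ψ) := by
    rw [hs', Complex.ofReal_zero, dotProduct_star_self_eq_zero] at hs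
    exact sub_eq_zero.1 hs
  have hyc : (y : ℂ) ≠ 0 := by exact_mod_cast hypos.ne'
  have hzc : (z : ℂ) ≠ 0 := by exact_mod_cast hzpos.ne'
  have h1 : X *ᵥ (Y *ᵥ ψ) = Y *ᵥ ψ := by
    apply smul_right_injective _ hzc
    change (z : ℂ) • (X *ᵥ (Y *ᵥ ψ)) = (z : ℂ) • (Y *ᵥ ψ)
    rw [← mulVec_smul, ← hprop, mulVec_smul, hXX]
  have h2 : Y *ᵥ (X *ᵥ ψ) = X *ᵥ ψ := by
    apply smul_right_injective _ hyc
    change (y : ℂ) • (Y *ᵥ (X *ᵥ ψ)) = (y : ℂ) • (X *ᵥ ψ)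
    rw [← mulVec_smul, hprop, mulVec_smul, hYY]
  refine ⟨?_, hXX⟩
  rw [← h2, mulVec_mulVec, ← hXY, ← mulVec_mulVec, h1]

end Saturation

section Schmidt

variable {m n : Type} [Fintype m] [Fintype n]

/-- Schmidt (singular value) decomposition of a rectangular matrix. -/
lemma Matrix.exists_schmidt_decomposition (M : Matrix m n ℂ) :
    ∃ (L : Type) (_ : Fintype L) (_ : DecidableEq L) (u : L → m → ℂ) (v : L → n → ℂ)
      (lam : L → ℝ),
      (∀ k l, star (u k) ⬝ᵥ u l = if k = l then 1 else 0) ∧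
      (∀ k l, star (v k) ⬝ᵥ v l = if k = l then 1 else 0) ∧
      (∀ k, 0 < lam k) ∧
      ∀ i j, M i j = ∑ k, (lam k : ℂ) * u k i * v k j := by
  classical
  have hH := posSemidef_self_mul_conjTranspose M
  set e := hH.1.eigenvalues
  have he0 : ∀ i, 0 ≤ e i := hH.eigenvalues_nonneg
  set U : Matrix m m ℂ := (hH.1.eigenvectorUnitary).1
  have hUU : Uᴴ * U = 1 := Unitary.coe_star_mul_self _
  have hUU' : U * Uᴴ = 1 := Unitary.coe_mul_star_self _
  have hW : (Uᴴ * M) * (Uᴴ * M)ᴴ = diagonal fun i => (e i : ℂ) := by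
    have := hH.1.conjStarAlgAut_star_eigenvectorUnitary
    rw [Unitary.conjStarAlgAut_star_apply] at this
    rw [conjTranspose_mul, conjTranspose_conjTranspose]
    simpa only [Matrix.mul_assoc] using! this
  have hM : M = U * (Uᴴ * M) := by rw [← Matrix.mul_assoc, hUU', Matrix.one_mul]
  set W := Uᴴ * M
  have hrow : ∀ i j, star (W i) ⬝ᵥ W j = if i = j then (e i : ℂ) else 0 := by
    intro i j
    have := congrFun (congrFun hW j) i
    rw [mul_apply, diagonal_apply] at this
    rw [dotProduct_comm]
    simp only [dotProduct, Pi.star_apply, conjTranspose_apply] at this ⊢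
    rw [this]
    by_cases h : i = j
    · simp [h]
    · simp [h, Ne.symm h]
  refine ⟨{i // e i ≠ 0}, inferInstance, inferInstance, fun k i => U i k,
    fun k => ((Real.sqrt (e k) : ℝ) : ℂ)⁻¹ • W k, fun k => Real.sqrt (e k), ?_, ?_, ?_, ?_⟩
  · intro k l
    have := congrFun (congrFun hUU k) l
    rw [mul_apply, one_apply] at this
    simpa only [dotProduct, Pi.star_apply, conjTranspose_apply, Subtype.ext_iff] using this
  · intro k l
    rw [star_smul, smul_dotProduct, dotProduct_smul, hrow]
    by_cases h : k = l
    · subst h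
      have hs : ((Real.sqrt (e k) : ℝ) : ℂ) * (Real.sqrt (e k) : ℝ) = e k := by
        rw [← Complex.ofReal_mul, Real.mul_self_sqrt (he0 k)]
      have hne : ((Real.sqrt (e k) : ℝ) : ℂ) ≠ 0 := by
        simpa [Real.sqrt_eq_zero (he0 k)] using k.2
      simp only [if_true, ← hs, smul_eq_mul, star_inv₀, Complex.star_def, Complex.conj_ofReal]
      field_simp
    · simp [h, Subtype.ext_iff.not.1 h]
  · exact fun k => Real.sqrt_pos.2 ((he0 k).lt_of_ne' k.2)
  · intro i j
    rw [hM, mul_apply]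
    symm
    calc _ = ∑ k : {i // e i ≠ 0}, U i k * W k j := by
          refine Finset.sum_congr rfl fun k _ => ?_
          have hne : ((Real.sqrt (e k) : ℝ) : ℂ) ≠ 0 := by
            simpa [Real.sqrt_eq_zero (he0 k)] using k.2
          simp only [Pi.smul_apply, smul_eq_mul]
          field_simp
      _ = _ := by
          rw [← Finset.sum_subtype (Finset.univ.filter fun k => e k ≠ 0) (by simp)
            (fun k => U i k * W k j)]
          refine Finset.sum_filter_of_ne fun k _ hk hek => hk ?_
          have hWk : W k = 0 := by
            rw [← dotProduct_star_self_eq_zero, hrow, if_pos rfl, hek, Complex.ofReal_zero]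
          rw [hWk, Pi.zero_apply, mul_zero]

/-- Expectation of a product operator whose factors are diagonal in a Schmidt basis. -/
lemma star_dotProduct_kronecker_mulVec_of_diagonal {L : Type*} [Fintype L] [DecidableEq L]
    {u : L → m → ℂ} {v : L → n → ℂ} {lam : L → ℝ}
    {ψ : m × n → ℂ} (hψ : ∀ z, ψ z = ∑ k, (lam k : ℂ) * u k z.1 * v k z.2)
    {X : Matrix m m ℂ} {Y : Matrix n n ℂ} {a b : L → ℝ}
    (hX : ∀ k l, star (u k) ⬝ᵥ (X *ᵥ u l) = if k = l then (a k : ℂ) else 0)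
    (hY : ∀ k l, star (v k) ⬝ᵥ (Y *ᵥ v l) = if k = l then (b k : ℂ) else 0) :
    star ψ ⬝ᵥ ((X ⊗ₖ Y) *ᵥ ψ) = ((∑ k, lam k ^ 2 * (a k * b k) : ℝ) : ℂ) := by
  have hψ' : ψ = ∑ k, (lam k : ℂ) • fun z : m × n => u k z.1 * v k z.2 := by
    ext z
    simp [hψ, mul_assoc]
  have hprod : ∀ (x x' : m → ℂ) (y y' : n → ℂ),
      star (fun z : m × n => x z.1 * y z.2) ⬝ᵥ ((X ⊗ₖ Y) *ᵥ fun z : m × n => x' z.1 * y' z.2) =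
        (star x ⬝ᵥ (X *ᵥ x')) * (star y ⬝ᵥ (Y *ᵥ y')) := by
    intro x x' y y'
    have hmul : ((X ⊗ₖ Y) *ᵥ fun z : m × n => x' z.1 * y' z.2) =
        fun z => (X *ᵥ x') z.1 * (Y *ᵥ y') z.2 := by
      ext z
      simp only [mulVec, dotProduct, kroneckerMap_apply, Fintype.sum_prod_type, Finset.sum_mul_sum]
      exact Finset.sum_congr rfl fun i _ => Finset.sum_congr rfl fun j _ => by ring
    rw [hmul]
    simp only [dotProduct, Fintype.sum_prod_type, Finset.sum_mul_sum, Pi.star_apply, star_mul']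
    exact Finset.sum_congr rfl fun i _ => Finset.sum_congr rfl fun j _ => by ring
  rw [hψ']
  simp only [star_sum, mulVec_sum, sum_dotProduct, dotProduct_sum, star_smul, mulVec_smul,
    smul_dotProduct, dotProduct_smul, hprod, hX, hY]
  simp [pow_two, mul_assoc]

/-- A Schmidt decomposition of a matrix `P` on which `A` and `B` act by the scalar `c` consists of
eigenvectors of `A` and `B`. -/
lemma exists_schmidt_decomposition_eigenvector {A : Matrix m m ℂ} {B : Matrix n n ℂ}
    {P : Matrix m n ℂ} {c : ℂ} (hA : A * P = c • P) (hB : P * Bᵀ = c • P) :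
    ∃ (L : Type) (_ : Fintype L) (_ : DecidableEq L) (u : L → m → ℂ) (v : L → n → ℂ)
      (lam : L → ℝ),
      (∀ k l, star (u k) ⬝ᵥ u l = if k = l then 1 else 0) ∧
      (∀ k l, star (v k) ⬝ᵥ v l = if k = l then 1 else 0) ∧
      (∀ k, 0 < lam k) ∧
      (∀ i j, P i j = ∑ k, (lam k : ℂ) * u k i * v k j) ∧
      (∀ k, A *ᵥ u k = c • u k) ∧ ∀ k, B *ᵥ v k = c • v k := by
  obtain ⟨L, _, _, u, v, lam, hu, hv, hlam, hP⟩ := P.exists_schmidt_decomposition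
  refine ⟨L, _, _, u, v, lam, hu, hv, hlam, hP, fun k => ?_, fun k => ?_⟩
  · have hPv : P *ᵥ star (v k) = (lam k : ℂ) • u k := by
      have : P = ∑ l, (lam l : ℂ) • vecMulVec (u l) (v l) := by
        ext i j
        simp [hP, Matrix.sum_apply, vecMulVec_apply, mul_assoc]
      rw [this, sum_mulVec]
      simp [smul_mulVec, vecMulVec_mulVec, dotProduct_comm _ (star (v k)), hv]
    have hne : (lam k : ℂ) ≠ 0 := by exact_mod_cast (hlam k).ne'
    apply smul_right_injective _ hne
    change (lam k : ℂ) • (A *ᵥ u k) = (lam k : ℂ) • (c • u k)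
    rw [← mulVec_smul, smul_comm, ← hPv, mulVec_mulVec, hA, smul_mulVec]
  · have hPu : Pᵀ *ᵥ star (u k) = (lam k : ℂ) • v k := by
      have : Pᵀ = ∑ l, (lam l : ℂ) • vecMulVec (v l) (u l) := by
        ext i j
        simp only [transpose_apply, hP, Matrix.sum_apply, Matrix.smul_apply,
          vecMulVec_apply, smul_eq_mul]
        exact Finset.sum_congr rfl fun l _ => by ring
      rw [this, sum_mulVec]
      simp [smul_mulVec, vecMulVec_mulVec, dotProduct_comm _ (star (u k)), hu]
    have hB' : B * Pᵀ = c • Pᵀ := by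
      rw [← transpose_smul, ← hB, transpose_mul, transpose_transpose]
    have hne : (lam k : ℂ) ≠ 0 := by exact_mod_cast (hlam k).ne'
    apply smul_right_injective _ hne
    change (lam k : ℂ) • (B *ᵥ v k) = (lam k : ℂ) • (c • v k)
    rw [← mulVec_smul, smul_comm, ← hPu, mulVec_mulVec, hB', smul_mulVec]

end Schmidt

/-- Quantum Finner rigidity for one bipartite source: with `ψ` a unit vector,
`0 ⪯ A ⪯ 1`, `0 ⪯ B ⪯ 1`, and `⟨ψ,(A⊗B)ψ⟩ > 0`, equality
`⟨ψ,(A⊗B)ψ⟩ = √(⟨ψ,(A⊗1)ψ⟩·⟨ψ,(1⊗B)ψ⟩)` holds iff there is a Schmidt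
decomposition `ψ = ∑ ℓ λ_ℓ u_ℓ ⊗ v_ℓ` in which both `A` and `B` act as the same
diagonal `0/1`-projector `χ`. -/
theorem quantum_finner_rigidity_one_source {dA dB : ℕ}
    (ψ : Fin dA × Fin dB → ℂ) (hψ : star ψ ⬝ᵥ ψ = 1)
    (A : Matrix (Fin dA) (Fin dA) ℂ) (hA : A.PosSemidef)
    (hA1 : ((1 : Matrix (Fin dA) (Fin dA) ℂ) - A).PosSemidef)
    (B : Matrix (Fin dB) (Fin dB) ℂ) (hB : B.PosSemidef)
    (hB1 : ((1 : Matrix (Fin dB) (Fin dB) ℂ) - B).PosSemidef)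
    (hpos : 0 < star ψ ⬝ᵥ ((A ⊗ₖ B) *ᵥ ψ)) :
    ((star ψ ⬝ᵥ ((A ⊗ₖ B) *ᵥ ψ)).re
        = Real.sqrt ((star ψ ⬝ᵥ ((A ⊗ₖ (1 : Matrix (Fin dB) (Fin dB) ℂ)) *ᵥ ψ)).re *
            (star ψ ⬝ᵥ (((1 : Matrix (Fin dA) (Fin dA) ℂ) ⊗ₖ B) *ᵥ ψ)).re))
    ↔ ∃ (m : ℕ) (u : Fin m → Fin dA → ℂ) (v : Fin m → Fin dB → ℂ)
        (lam : Fin m → ℝ) (χ : Fin m → ℝ),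
        (∀ ℓ ℓ', star (u ℓ) ⬝ᵥ u ℓ' = if ℓ = ℓ' then 1 else 0) ∧
        (∀ ℓ ℓ', star (v ℓ) ⬝ᵥ v ℓ' = if ℓ = ℓ' then 1 else 0) ∧
        (∀ ℓ, 0 < lam ℓ) ∧ (∑ ℓ, lam ℓ ^ 2 = 1) ∧
        (∀ ℓ, χ ℓ = 0 ∨ χ ℓ = 1) ∧
        (∀ z : Fin dA × Fin dB, ψ z = ∑ ℓ, (lam ℓ : ℂ) * u ℓ z.1 * v ℓ z.2) ∧
        (∀ ℓ ℓ', star (u ℓ) ⬝ᵥ (A *ᵥ u ℓ') = if ℓ = ℓ' then (χ ℓ : ℂ) else 0) ∧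
        (∀ ℓ ℓ', star (v ℓ) ⬝ᵥ (B *ᵥ v ℓ') = if ℓ = ℓ' then (χ ℓ : ℂ) else 0) := by
  constructor
  · intro heq
    have hcomm : (A ⊗ₖ (1 : Matrix (Fin dB) (Fin dB) ℂ)) *
        ((1 : Matrix (Fin dA) (Fin dA) ℂ) ⊗ₖ B) = A ⊗ₖ B := by rw [← mul_kronecker_mul, mul_one, one_mul]
    have hcomm' : ((1 : Matrix (Fin dA) (Fin dA) ℂ) ⊗ₖ B) *
        (A ⊗ₖ (1 : Matrix (Fin dB) (Fin dB) ℂ)) = A ⊗ₖ B := by rw [← mul_kronecker_mul, mul_one, one_mul]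
    have hX1 : (1 - A ⊗ₖ (1 : Matrix (Fin dB) (Fin dB) ℂ)).PosSemidef := by
      have h : (1 - A) ⊗ₖ (1 : Matrix (Fin dB) (Fin dB) ℂ) + A ⊗ₖ 1 = 1 := by
        rw [← add_kronecker, sub_add_cancel, one_kronecker_one]
      exact eq_sub_of_add_eq h ▸ hA1.kronecker .one
    have hY1 : (1 - (1 : Matrix (Fin dA) (Fin dA) ℂ) ⊗ₖ B).PosSemidef := by
      have h : (1 : Matrix (Fin dA) (Fin dA) ℂ) ⊗ₖ (1 - B) + 1 ⊗ₖ B = 1 := by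
        rw [← kronecker_add, sub_add_cancel, one_kronecker_one]
      exact eq_sub_of_add_eq h ▸ PosSemidef.one.kronecker hB1
    rw [← hcomm] at hpos heq
    obtain ⟨hXY, hXX⟩ := mulVec_eq_of_saturation (hA.kronecker .one) hX1
      (PosSemidef.one.kronecker hB) hY1 (hcomm.trans hcomm'.symm) ψ hpos heq
    obtain ⟨N, rfl⟩ := vec_bijective.2 ψ
    obtain ⟨M, rfl⟩ : ∃ M, N = Mᵀ := ⟨Nᵀ, N.transpose_transpose.symm⟩
    simp only [kronecker_mulVec_vec, vec_inj, Matrix.one_mul, transpose_one, Matrix.mul_one,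
      ← transpose_mul] at hXY hXX
    have hXY : A * M = M * Bᵀ := by
      rw [← transpose_inj, hXY, transpose_mul, transpose_transpose]
    have hXX : A * (A * M) = A * M := transpose_inj.1 hXX
    obtain ⟨L₁, _, _, u₁, v₁, lam₁, hu₁, hv₁, hlam₁, hP₁, hA₁, hB₁⟩ :=
      exists_schmidt_decomposition_eigenvector (A := A) (B := B) (P := A * M) (c := 1)
        (by rw [hXX, one_smul]) (by rw [Matrix.mul_assoc, ← hXY, hXX, one_smul])
    obtain ⟨L₀, _, _, u₀, v₀, lam₀, hu₀, hv₀, hlam₀, hP₀, hA₀, hB₀⟩ :=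
      exists_schmidt_decomposition_eigenvector (A := A) (B := B) (P := M - A * M) (c := 0)
        (by rw [Matrix.mul_sub, hXX, sub_self, zero_smul])
        (by rw [Matrix.sub_mul, Matrix.mul_assoc, ← hXY, hXX, sub_self, zero_smul])
    let f := (Fintype.equivFin (L₁ ⊕ L₀)).symm
    let u : L₁ ⊕ L₀ → Fin dA → ℂ := Sum.elim u₁ u₀
    let v : L₁ ⊕ L₀ → Fin dB → ℂ := Sum.elim v₁ v₀
    let lam : L₁ ⊕ L₀ → ℝ := Sum.elim lam₁ lam₀
    let χ : L₁ ⊕ L₀ → ℝ := Sum.elim 1 0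
    have hu : ∀ k l, star (u k) ⬝ᵥ u l = if k = l then 1 else 0 := by
      rintro (k | k) (l | l)
      · simp [u, hu₁]
      · simpa [u] using hA.1.star_dotProduct_eq_zero (hA₁ k) (hA₀ l) (by simp)
      · simpa [u] using hA.1.star_dotProduct_eq_zero (hA₀ k) (hA₁ l) (by simp)
      · simp [u, hu₀]
    have hv : ∀ k l, star (v k) ⬝ᵥ v l = if k = l then 1 else 0 := by
      rintro (k | k) (l | l)
      · simp [v, hv₁]
      · simpa [v] using hB.1.star_dotProduct_eq_zero (hB₁ k) (hB₀ l) (by simp)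
      · simpa [v] using hB.1.star_dotProduct_eq_zero (hB₀ k) (hB₁ l) (by simp)
      · simp [v, hv₀]
    have hAu : ∀ k, A *ᵥ u k = (χ k : ℂ) • u k := by
      rintro (k | k)
      · simp [u, χ, hA₁]
      · simp [u, χ, hA₀]
    have hBv : ∀ k, B *ᵥ v k = (χ k : ℂ) • v k := by
      rintro (k | k)
      · simp [v, χ, hB₁]
      · simp [v, χ, hB₀]
    have hdec : ∀ z : Fin dA × Fin dB,
        vec Mᵀ z = ∑ k, (lam k : ℂ) * u k z.1 * v k z.2 := by
      intro z
      rw [Fintype.sum_sum_type]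
      simp only [u, v, lam, Sum.elim_inl, Sum.elim_inr, ← hP₁, ← hP₀]
      simp [vec]
    have hsum : ∑ k, lam k ^ 2 = 1 := by
      have := star_dotProduct_kronecker_mulVec_of_diagonal hdec
        (X := 1) (Y := 1) (a := fun _ => 1) (b := fun _ => 1)
        (by simpa using hu) (by simpa using hv)
      simp only [one_kronecker_one, one_mulVec, hψ, mul_one] at this
      exact_mod_cast this.symm
    refine ⟨Fintype.card (L₁ ⊕ L₀), u ∘ f, v ∘ f, lam ∘ f, χ ∘ f, ?_, ?_, ?_, ?_, ?_, ?_, ?_, ?_⟩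
    · intro k l
      simp [hu]
    · intro k l
      simp [hv]
    · intro k
      change 0 < lam (f k)
      rcases f k with k | k
      · exact hlam₁ k
      · exact hlam₀ k
    · rw [← hsum]
      exact f.sum_comp fun k => lam k ^ 2
    · intro k
      change χ (f k) = 0 ∨ χ (f k) = 1
      rcases f k with k | k
      · exact Or.inr rfl
      · exact Or.inl rfl
    · intro z
      rw [hdec]
      exact (f.sum_comp fun k => (lam k : ℂ) * u k z.1 * v k z.2).symm
    · intro k l
      simp only [Function.comp_apply, hAu, dotProduct_smul, hu, f.injective.eq_iff]
      split_ifs with h <;> simp [h]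
    · intro k l
      simp only [Function.comp_apply, hBv, dotProduct_smul, hv, f.injective.eq_iff]
      split_ifs with h <;> simp [h]
  · rintro ⟨m, u, v, lam, χ, hu, hv, -, -, hχ, hdec, hAu, hBv⟩
    have hχχ : ∀ k, χ k * χ k = χ k := fun k => by rcases hχ k with h | h <;> simp [h]
    have hAB := star_dotProduct_kronecker_mulVec_of_diagonal hdec hAu hBv
    have hA' := star_dotProduct_kronecker_mulVec_of_diagonal hdec (Y := 1) (b := fun _ => 1) hAu
      (by simpa using hv)
    have hB' := star_dotProduct_kronecker_mulVec_of_diagonal hdec (X := 1) (a := fun _ => 1)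
      (by simpa using hu) hBv
    have hnonneg : 0 ≤ ∑ k, lam k ^ 2 * χ k := Finset.sum_nonneg fun k _ =>
      mul_nonneg (sq_nonneg _) (hχχ k ▸ mul_self_nonneg _)
    simp only [hAB, hA', hB', hχχ, mul_one, one_mul, Complex.ofReal_re,
      Real.sqrt_mul_self hnonneg]
end

section
/- (Quantum Finner inequality for the triangle network.) Let positive integers a₁, a₂, b₁, b₂, c₁, c₂ be given. Let ψ_α ∈ ℂ^{b₁} ⊗ ℂ^{c₁}, ψ_β ∈ ℂ^{c₂} ⊗ ℂ^{a₁}, ψ_γ ∈ ℂ^{a₂} ⊗ ℂ^{b₂} be unit vectors, and define the global unit vector Ψ, indexed by tuples (i₁ ∈ Fin a₁, i₂ ∈ Fin a₂, j₁ ∈ Fin b₁, j₂ ∈ Fin b₂, k₁ ∈ Fin c₁, k₂ ∈ Fin c₂), by Ψ(i₁,i₂,j₁,j₂,k₁,k₂) = ψ_β(k₂,i₁) · ψ_γ(i₂,j₂) · ψ_α(j₁,k₁). Let M_A be Hermitian with 0 ⪯ M_A ⪯ 1 acting on indices (i₁,i₂), M_B Hermitian with 0 ⪯ M_B ⪯ 1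 acting on indices (j₁,j₂), and M_C Hermitian with 0 ⪯ M_C ⪯ 1 acting on indices (k₁,k₂), and let M_A ⊗ M_B ⊗ M_C, M_A ⊗ 1 ⊗ 1, 1 ⊗ M_B ⊗ 1, 1 ⊗ 1 ⊗ M_C denote the corresponding operators on the global index space acting entrywise on their respective index pairs and as identity elsewhere. Then ⟨Ψ, (M_A ⊗ M_B ⊗ M_C)Ψ⟩ ≤ √( ⟨Ψ, (M_A⊗1⊗1)Ψ⟩ · ⟨Ψ, (1⊗M_B⊗1)Ψ⟩ · ⟨Ψ, (1⊗1⊗M_C)Ψ⟩ ). -/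
open Matrix Kronecker ComplexOrder

/-- A Schmidt decomposition whose coefficients are split evenly between the two factors:
`ψ = ∑ r, L r ⊗ R r` with `L` and `R` having orthogonal columns of equal norms. -/
lemma exists_balanced_schmidt {m n : Type*} [Fintype m] [Fintype n] [DecidableEq n]
    (ψ : m × n → ℂ) :
    ∃ (d : n → ℂ) (L : Matrix m n ℂ) (R : Matrix n n ℂ),
      (∀ i j, ψ (i, j) = ∑ r, L i r * R j r) ∧
      Lᴴ * L = diagonal d ∧ Rᴴ * R = diagonal d ∧ ∑ r, d r * d r = star ψ ⬝ᵥ ψ := by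
  set K : Matrix m n ℂ := of fun i j => ψ (i, j) with hK
  have hH : (Kᴴ * K).PosSemidef := posSemidef_conjTranspose_mul_self K
  set e := hH.isHermitian.eigenvalues
  have he0 : ∀ r, 0 ≤ e r := hH.eigenvalues_nonneg
  set V : Matrix n n ℂ := hH.isHermitian.eigenvectorUnitary.1
  have hVV : V * Vᴴ = 1 := (mem_unitaryGroup_iff (A := V)).mp hH.isHermitian.eigenvectorUnitary.2
  have hVV' : Vᴴ * V = 1 := (mem_unitaryGroup_iff' (A := V)).mp hH.isHermitian.eigenvectorUnitary.2
  have hspec : Kᴴ * K = V * diagonal (fun r => (e r : ℂ)) * Vᴴ := by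
    have := hH.isHermitian.spectral_theorem
    rw [Unitary.conjStarAlgAut_apply] at this
    exact this
  have hD : (K * V)ᴴ * (K * V) = diagonal (fun r => (e r : ℂ)) := by
    rw [conjTranspose_mul, Matrix.mul_assoc, ← Matrix.mul_assoc Kᴴ, hspec]
    simp only [Matrix.mul_assoc, hVV', Matrix.mul_one]
    rw [← Matrix.mul_assoc, hVV', Matrix.one_mul]
  set q : n → ℝ := fun r => √(√(e r))
  have hqq : ∀ r, q r * q r = √(e r) := fun r => Real.mul_self_sqrt (Real.sqrt_nonneg _)
  have hqe : ∀ r, (q r * q r) * (q r * q r) = e r := fun r => by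
    rw [hqq]; exact Real.mul_self_sqrt (he0 r)
  have hL : (K * V * diagonal (fun r => ((q r)⁻¹ : ℂ)))ᴴ *
      (K * V * diagonal (fun r => ((q r)⁻¹ : ℂ))) = diagonal (fun r => ((q r * q r : ℝ) : ℂ)) := by
    rw [conjTranspose_mul, Matrix.mul_assoc, ← Matrix.mul_assoc (K * V)ᴴ, hD,
      diagonal_conjTranspose, diagonal_mul_diagonal, diagonal_mul_diagonal]
    congr 1
    ext r
    simp only [Pi.star_apply, star_inv₀, RCLike.star_def, Complex.conj_ofReal, ← hqe r]
    by_cases h : q r = 0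
    · simp [h]
    · have : (q r : ℂ) ≠ 0 := by exact_mod_cast h
      push_cast
      field_simp
  have hR : (V.map star * diagonal (fun r => (q r : ℂ)))ᴴ *
      (V.map star * diagonal (fun r => (q r : ℂ))) = diagonal (fun r => ((q r * q r : ℝ) : ℂ)) := by
    have hVc : (V.map star)ᴴ * V.map star = 1 := by
      have : (V.map star)ᴴ * V.map star = (Vᴴ * V)ᵀ := by
        rw [transpose_mul]
        ext i j
        simp [Matrix.mul_apply]
      rw [this, hVV', transpose_one]
    rw [conjTranspose_mul, Matrix.mul_assoc, ← Matrix.mul_assoc (V.map star)ᴴ, hVc,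
      Matrix.one_mul, diagonal_conjTranspose, diagonal_mul_diagonal]
    congr 1
    ext r
    simp
  have hKV : K * V * diagonal (fun r => ((q r)⁻¹ : ℂ)) * diagonal (fun r => (q r : ℂ)) = K * V := by
    rw [Matrix.mul_assoc, diagonal_mul_diagonal]
    ext i r
    rw [mul_diagonal]
    by_cases h : q r = 0
    · have h0 : ((K * V)ᴴ * (K * V)) r r = 0 := by
        rw [hD, diagonal_apply_eq, ← hqe r, h]; simp
      have h1 : (K * V) i r = 0 := by
        rw [Matrix.mul_apply] at h0
        have := (Finset.sum_eq_zero_iff_of_nonneg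
          (fun i _ => by rw [conjTranspose_apply]; exact star_mul_self_nonneg _)).mp h0 i
            (Finset.mem_univ i)
        simpa using this
      rw [h1, zero_mul]
    · have : (q r : ℂ) ≠ 0 := by exact_mod_cast h
      rw [inv_mul_cancel₀ this, mul_one]
  refine ⟨fun r => ((q r * q r : ℝ) : ℂ), K * V * diagonal (fun r => ((q r)⁻¹ : ℂ)),
    V.map star * diagonal (fun r => (q r : ℂ)), fun i j => ?_, hL, hR, ?_⟩
  · have h : K = K * V * diagonal (fun r => ((q r)⁻¹ : ℂ)) * diagonal (fun r => (q r : ℂ)) * Vᴴ := by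
      rw [hKV, Matrix.mul_assoc, hVV, Matrix.mul_one]
    have h' := congrFun (congrFun h i) j
    rw [Matrix.mul_assoc _ _ Vᴴ, Matrix.mul_apply] at h'
    change K i j = _
    rw [h']
    refine Finset.sum_congr rfl fun r _ => ?_
    rw [diagonal_mul, mul_diagonal _ (V.map star), conjTranspose_apply, map_apply,
      mul_comm (q r : ℂ)]
  · have htr : (Kᴴ * K).trace = star ψ ⬝ᵥ ψ := by
      simp only [trace, diag_apply, Matrix.mul_apply, dotProduct, Fintype.sum_prod_type, hK,
        conjTranspose_apply, of_apply, Pi.star_apply]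
      exact Finset.sum_comm
    rw [← htr, hspec, trace_mul_comm, ← Matrix.mul_assoc, hVV', Matrix.one_mul, trace_diagonal]
    exact Finset.sum_congr rfl fun r _ => by rw [← hqe r]; push_cast; ring

/-- For an effect `0 ≤ A ≤ 1`, the squared Frobenius norm of `Tᴴ A T` is at most `tr (A (T Tᴴ)²)`. -/
lemma sum_norm_sq_conj_le {m n : Type*} [Fintype m] [Fintype n] [DecidableEq m]
    {A : Matrix m m ℂ} (hA : A.PosSemidef) (hA1 : (1 - A).PosSemidef) (T : Matrix m n ℂ) :
    ∑ r, ∑ s, ‖(Tᴴ * A * T) r s‖ ^ 2 ≤ ((Tᴴ * A * T) * (Tᴴ * T)).trace.re := by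
  set P : Matrix m m ℂ := T * Tᴴ with hP
  have hAh : Aᴴ = A := hA.isHermitian
  have hPh : Pᴴ = P := by simp [hP]
  have hN : ∑ r, ∑ s, ‖(Tᴴ * A * T) r s‖ ^ 2 = (A * P * A * P).trace.re := by
    have h1 : ((Tᴴ * A * T)ᴴ * (Tᴴ * A * T)).trace = (A * P * A * P).trace := by
      simp only [conjTranspose_mul, conjTranspose_conjTranspose, hAh, hP, Matrix.mul_assoc]
      rw [trace_mul_comm]
      simp only [Matrix.mul_assoc]
    rw [← h1, Finset.sum_comm]
    simp only [trace, diag_apply, Matrix.mul_apply (M := (Tᴴ * A * T)ᴴ), conjTranspose_apply,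
      Complex.re_sum]
    refine Finset.sum_congr rfl fun r _ => Finset.sum_congr rfl fun s _ => ?_
    rw [RCLike.star_def, Complex.conj_mul']
    norm_cast
  have hG : ((Tᴴ * A * T) * (Tᴴ * T)).trace = (P * A * P).trace := by
    rw [Matrix.mul_assoc P, trace_mul_comm P, Matrix.mul_assoc Tᴴ, Matrix.mul_assoc Tᴴ,
      trace_mul_comm Tᴴ]
    simp only [hP, Matrix.mul_assoc]
  rw [hN, hG]
  have hcomm : 0 ≤ ((A * P - P * A)ᴴ * (A * P - P * A)).trace.re :=
    (Complex.le_def.mp (posSemidef_conjTranspose_mul_self (A * P - P * A)).trace_nonneg).1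
  have hexp : ((A * P - P * A)ᴴ * (A * P - P * A)).trace =
      2 * (P * (A * A) * P).trace - 2 * (A * P * A * P).trace := by
    have t1 : (A * (P * (P * A))).trace = (P * (A * (A * P))).trace := by
      rw [← Matrix.mul_assoc, trace_mul_comm]; simp only [Matrix.mul_assoc]
    have t2 : (P * (A * (P * A))).trace = (A * (P * (A * P))).trace := by
      rw [trace_mul_comm]; simp only [Matrix.mul_assoc]
    simp only [conjTranspose_sub, conjTranspose_mul, hAh, hPh, Matrix.sub_mul, Matrix.mul_sub,
      trace_sub, Matrix.mul_assoc, t1, t2]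
    ring
  have hsq : (A - A * A).PosSemidef := by
    have h1 := hA1.mul_mul_conjTranspose_same A
    have h2 := hA.mul_mul_conjTranspose_same (1 - A)
    have h3 := h1.add h2
    rw [conjTranspose_sub, conjTranspose_one, hAh] at h3
    convert h3 using 1
    noncomm_ring
  have hle : 0 ≤ (P * (A - A * A) * P).trace.re := by
    have h := hsq.mul_mul_conjTranspose_same P
    rw [hPh] at h
    exact (Complex.le_def.mp h.trace_nonneg).1
  rw [hexp] at hcomm
  rw [Matrix.mul_sub, Matrix.sub_mul, trace_sub] at hle
  simp only [Complex.sub_re, Complex.mul_re, Complex.re_ofNat, Complex.im_ofNat] at hcomm hle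
  linarith

/-- The discrete Loomis–Whitney inequality in three variables. -/
lemma sum_mul_mul_le_sqrt {X Y Z : Type*} [Fintype X] [Fintype Y] [Fintype Z]
    (f : X → Y → ℝ) (g : Z → Y → ℝ) (h : Z → X → ℝ) :
    ∑ x, ∑ y, ∑ z, f x y * g z y * h z x ≤
      √((∑ x, ∑ y, f x y ^ 2) * (∑ z, ∑ y, g z y ^ 2) * (∑ z, ∑ x, h z x ^ 2)) := by
  apply Real.le_sqrt_of_sq_le
  have h1 : ∑ x, ∑ y, ∑ z, f x y * g z y * h z x =
      ∑ p : X × Y, f p.1 p.2 * ∑ z, g z p.2 * h z p.1 := by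
    rw [Fintype.sum_prod_type]
    simp only [Finset.mul_sum, mul_assoc]
  rw [h1]
  refine (Finset.sum_mul_sq_le_sq_mul_sq _ _ _).trans ?_
  rw [Fintype.sum_prod_type, mul_assoc]
  refine mul_le_mul_of_nonneg_left ?_ (by positivity)
  calc ∑ p : X × Y, (∑ z, g z p.2 * h z p.1) ^ 2
      ≤ ∑ p : X × Y, (∑ z, g z p.2 ^ 2) * ∑ z, h z p.1 ^ 2 :=
        Finset.sum_le_sum fun p _ => Finset.sum_mul_sq_le_sq_mul_sq _ _ _
    _ = _ := by
        rw [Fintype.sum_prod_type, Finset.sum_comm (f := fun z y => g z y ^ 2),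
          Finset.sum_comm (f := fun z x => h z x ^ 2), Finset.sum_mul_sum]
        exact Finset.sum_comm

/-- The contraction of three bipartite operators along the edges of a triangle. -/
def triangleContraction {X Y Z : Type*} [Fintype X] [Fintype Y] [Fintype Z]
    (A : Matrix (X × Y) (X × Y) ℂ) (B : Matrix (Z × Y) (Z × Y) ℂ)
    (C : Matrix (Z × X) (Z × X) ℂ) : ℂ :=
  ∑ x : X × X, ∑ y : Y × Y, ∑ z : Z × Z,
    A (x.1, y.1) (x.2, y.2) * B (z.1, y.1) (z.2, y.2) * C (z.1, x.1) (z.2, x.2)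

section Triangle

variable {X Y Z : Type*} [Fintype X] [Fintype Y] [Fintype Z]

/-- Grouping row and column indices by factor does not change the sum of squared entries. -/
lemma sum_prod_prod_norm_sq {U V : Type*} [Fintype U] [Fintype V]
    (A : Matrix (U × V) (U × V) ℂ) :
    ∑ u : U × U, ∑ v : V × V, ‖A (u.1, v.1) (u.2, v.2)‖ ^ 2 = ∑ r, ∑ s, ‖A r s‖ ^ 2 := by
  simp only [Fintype.sum_prod_type]
  exact Finset.sum_congr rfl fun _ _ => Finset.sum_comm

lemma re_triangleContraction_le (A : Matrix (X × Y) (X × Y) ℂ) (B : Matrix (Z × Y) (Z × Y) ℂ)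
    (C : Matrix (Z × X) (Z × X) ℂ) :
    (triangleContraction A B C).re ≤
      √((∑ r, ∑ s, ‖A r s‖ ^ 2) * (∑ r, ∑ s, ‖B r s‖ ^ 2) * (∑ r, ∑ s, ‖C r s‖ ^ 2)) := by
  have h := sum_mul_mul_le_sqrt
    (fun (x : X × X) (y : Y × Y) => ‖A (x.1, y.1) (x.2, y.2)‖)
    (fun (z : Z × Z) (y : Y × Y) => ‖B (z.1, y.1) (z.2, y.2)‖)
    (fun (z : Z × Z) (x : X × X) => ‖C (z.1, x.1) (z.2, x.2)‖)
  simp only [sum_prod_prod_norm_sq] at h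
  refine le_trans ?_ h
  simp only [triangleContraction, Complex.re_sum]
  gcongr
  refine (Complex.re_le_norm _).trans ?_
  rw [norm_mul, norm_mul]

variable [DecidableEq X] [DecidableEq Y] [DecidableEq Z]

lemma triangleContraction_diagonal_right (A : Matrix (X × Y) (X × Y) ℂ) (p : X → ℂ) (q : Y → ℂ)
    (r : Z → ℂ) (hr : ∑ z, r z * r z = 1) :
    triangleContraction A (diagonal r ⊗ₖ diagonal q) (diagonal r ⊗ₖ diagonal p) =
      (A * (diagonal p ⊗ₖ diagonal q)).trace := by
  simp only [triangleContraction, diagonal_kronecker_diagonal, trace, diag_apply, mul_diagonal,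
    Fintype.sum_prod_type, diagonal_apply, Prod.mk.injEq]
  have h : ∀ x x' y y' z z', A (x, y) (x', y') * (if z = z' ∧ y = y' then r z * q y else 0) *
      (if z = z' ∧ x = x' then r z * p x else 0) =
      if x = x' then if y = y' then if z = z' then
        (A (x, y) (x, y) * (p x * q y)) * (r z * r z) else 0 else 0 else 0 := by
    intros
    split_ifs <;> simp_all
    ring
  simp only [h]
  simp [← Finset.mul_sum, hr]

lemma triangleContraction_diagonal_middle (B : Matrix (Z × Y) (Z × Y) ℂ) (p : X → ℂ) (q : Y → ℂ)
    (r : Z → ℂ) (hp : ∑ x, p x * p x = 1) :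
    triangleContraction (diagonal p ⊗ₖ diagonal q) B (diagonal r ⊗ₖ diagonal p) =
      (B * (diagonal r ⊗ₖ diagonal q)).trace := by
  simp only [triangleContraction, diagonal_kronecker_diagonal, trace, diag_apply, mul_diagonal,
    Fintype.sum_prod_type, diagonal_apply, Prod.mk.injEq]
  have h : ∀ x x' y y' z z', (if x = x' ∧ y = y' then p x * q y else 0) * B (z, y) (z', y') *
      (if z = z' ∧ x = x' then r z * p x else 0) =
      if x = x' then if y = y' then if z = z' then
        (p x * p x) * (B (z, y) (z, y) * (r z * q y)) else 0 else 0 else 0 := by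
    intros
    split_ifs <;> simp_all
    ring
  simp only [h]
  simp only [Finset.sum_ite_irrel, Finset.sum_ite_eq, Finset.mem_univ, if_true,
    Finset.sum_const_zero, ← Finset.mul_sum, ← Finset.sum_mul, hp, one_mul]
  exact Finset.sum_comm

lemma triangleContraction_diagonal_left (C : Matrix (Z × X) (Z × X) ℂ) (p : X → ℂ) (q : Y → ℂ)
    (r : Z → ℂ) (hq : ∑ y, q y * q y = 1) :
    triangleContraction (diagonal p ⊗ₖ diagonal q) (diagonal r ⊗ₖ diagonal q) C =
      (C * (diagonal r ⊗ₖ diagonal p)).trace := by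
  simp only [triangleContraction, diagonal_kronecker_diagonal, trace, diag_apply, mul_diagonal,
    Fintype.sum_prod_type, diagonal_apply, Prod.mk.injEq]
  have h : ∀ x x' y y' z z', (if x = x' ∧ y = y' then p x * q y else 0) *
      (if z = z' ∧ y = y' then r z * q y else 0) * C (z, x) (z', x') =
      if x = x' then if y = y' then if z = z' then
        (q y * q y) * (C (z, x) (z, x) * (r z * p x)) else 0 else 0 else 0 := by
    intros
    split_ifs <;> simp_all
    ring
  simp only [h]
  simp only [Finset.sum_ite_irrel, Finset.sum_ite_eq, Finset.mem_univ, if_true,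
    Finset.sum_const_zero, ← Finset.mul_sum, ← Finset.sum_mul, hq, one_mul]
  exact Finset.sum_comm

/-- Expectation values of product operators in a state obtained by applying local maps to three
unnormalised maximally entangled pairs are triangle contractions. -/
lemma dotProduct_kronecker_mulVec_eq {I J K : Type*} [Fintype I] [Fintype J] [Fintype K]
    (S : Matrix I (X × Y) ℂ) (T : Matrix J (Z × Y) ℂ) (U : Matrix K (Z × X) ℂ)
    (Ψ : I × (J × K) → ℂ)
    (hΨ : ∀ i j k, Ψ (i, (j, k)) = ∑ x, ∑ y, ∑ z, S i (x, y) * T j (z, y) * U k (z, x))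
    (A : Matrix I I ℂ) (B : Matrix J J ℂ) (C : Matrix K K ℂ) :
    star Ψ ⬝ᵥ ((A ⊗ₖ (B ⊗ₖ C)) *ᵥ Ψ) =
      triangleContraction (Sᴴ * A * S) (Tᴴ * B * T) (Uᴴ * C * U) := by
  set Ω : (X × Y) × ((Z × Y) × (Z × X)) → ℂ := fun w =>
    if w.1.1 = w.2.2.2 then if w.1.2 = w.2.1.2 then if w.2.1.1 = w.2.2.1 then 1 else 0 else 0 else 0
    with hΩ
  have hΨΩ : Ψ = (S ⊗ₖ (T ⊗ₖ U)) *ᵥ Ω := by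
    ext ⟨i, j, k⟩
    simp [hΨ, mulVec, dotProduct, Fintype.sum_prod_type, hΩ, mul_assoc]
  rw [hΨΩ, star_mulVec, ← dotProduct_mulVec, mulVec_mulVec, mulVec_mulVec,
    conjTranspose_kronecker, conjTranspose_kronecker,
    ← mul_kronecker_mul, ← mul_kronecker_mul, ← mul_kronecker_mul, ← mul_kronecker_mul]
  simp [triangleContraction, mulVec, dotProduct, Fintype.sum_prod_type, hΩ, mul_assoc,
    apply_ite (starRingEnd ℂ)]
  refine Finset.sum_congr rfl fun x _ => ?_
  rw [Finset.sum_comm (s := (Finset.univ : Finset X))]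
  refine Finset.sum_congr rfl fun y _ => ?_
  rw [Finset.sum_comm]
  exact Finset.sum_congr rfl fun x' _ => Finset.sum_comm

end Triangle

/-- Quantum Finner inequality for the triangle network: three bipartite sources
`ψα ∈ ℂ^{b₁}⊗ℂ^{c₁}`, `ψβ ∈ ℂ^{c₂}⊗ℂ^{a₁}`, `ψγ ∈ ℂ^{a₂}⊗ℂ^{b₂}` form the
global product state `Ψ`, and each party measures its two systems with a
Hermitian effect between `0` and `1`.  Then
`⟨Ψ,(M_A⊗M_B⊗M_C)Ψ⟩ ≤ √(⟨Ψ,(M_A⊗1⊗1)Ψ⟩·⟨Ψ,(1⊗M_B⊗1)Ψ⟩·⟨Ψ,(1⊗1⊗M_C)Ψ⟩)`. -/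
theorem quantum_finner_triangle {a₁ a₂ b₁ b₂ c₁ c₂ : ℕ}
    (ha₁ : 0 < a₁) (ha₂ : 0 < a₂) (hb₁ : 0 < b₁) (hb₂ : 0 < b₂)
    (hc₁ : 0 < c₁) (hc₂ : 0 < c₂)
    (ψα : Fin b₁ × Fin c₁ → ℂ) (hψα : star ψα ⬝ᵥ ψα = 1)
    (ψβ : Fin c₂ × Fin a₁ → ℂ) (hψβ : star ψβ ⬝ᵥ ψβ = 1)
    (ψγ : Fin a₂ × Fin b₂ → ℂ) (hψγ : star ψγ ⬝ᵥ ψγ = 1)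
    (Ψ : (Fin a₁ × Fin a₂) × ((Fin b₁ × Fin b₂) × (Fin c₁ × Fin c₂)) → ℂ)
    (hΨ : ∀ (i₁ : Fin a₁) (i₂ : Fin a₂) (j₁ : Fin b₁) (j₂ : Fin b₂)
        (k₁ : Fin c₁) (k₂ : Fin c₂),
        Ψ ((i₁, i₂), ((j₁, j₂), (k₁, k₂))) = ψβ (k₂, i₁) * ψγ (i₂, j₂) * ψα (j₁, k₁))
    (MA : Matrix (Fin a₁ × Fin a₂) (Fin a₁ × Fin a₂) ℂ) (hMA : MA.PosSemidef)
    (hMA1 : ((1 : Matrix (Fin a₁ × Fin a₂) (Fin a₁ × Fin a₂) ℂ) - MA).PosSemidef)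
    (MB : Matrix (Fin b₁ × Fin b₂) (Fin b₁ × Fin b₂) ℂ) (hMB : MB.PosSemidef)
    (hMB1 : ((1 : Matrix (Fin b₁ × Fin b₂) (Fin b₁ × Fin b₂) ℂ) - MB).PosSemidef)
    (MC : Matrix (Fin c₁ × Fin c₂) (Fin c₁ × Fin c₂) ℂ) (hMC : MC.PosSemidef)
    (hMC1 : ((1 : Matrix (Fin c₁ × Fin c₂) (Fin c₁ × Fin c₂) ℂ) - MC).PosSemidef) :
    (star Ψ ⬝ᵥ ((MA ⊗ₖ (MB ⊗ₖ MC)) *ᵥ Ψ)).re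
      ≤ Real.sqrt
          ((star Ψ ⬝ᵥ ((MA ⊗ₖ ((1 : Matrix (Fin b₁ × Fin b₂) (Fin b₁ × Fin b₂) ℂ) ⊗ₖ
              (1 : Matrix (Fin c₁ × Fin c₂) (Fin c₁ × Fin c₂) ℂ))) *ᵥ Ψ)).re *
           (star Ψ ⬝ᵥ (((1 : Matrix (Fin a₁ × Fin a₂) (Fin a₁ × Fin a₂) ℂ) ⊗ₖ (MB ⊗ₖ
              (1 : Matrix (Fin c₁ × Fin c₂) (Fin c₁ × Fin c₂) ℂ))) *ᵥ Ψ)).re *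
           (star Ψ ⬝ᵥ (((1 : Matrix (Fin a₁ × Fin a₂) (Fin a₁ × Fin a₂) ℂ) ⊗ₖ
              ((1 : Matrix (Fin b₁ × Fin b₂) (Fin b₁ × Fin b₂) ℂ) ⊗ₖ MC)) *ᵥ Ψ)).re) := by
  obtain ⟨p, Lβ, Rβ, hβ, hLβ, hRβ, hp⟩ := exists_balanced_schmidt ψβ
  obtain ⟨q, Lγ, Rγ, hγ, hLγ, hRγ, hq⟩ := exists_balanced_schmidt ψγ
  obtain ⟨r, Lα, Rα, hα, hLα, hRα, hr⟩ := exists_balanced_schmidt ψα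
  rw [hψβ] at hp
  rw [hψγ] at hq
  rw [hψα] at hr
  set S := Rβ ⊗ₖ Lγ with hS
  set T := Lα ⊗ₖ Rγ with hT
  set U := Rα ⊗ₖ Lβ with hU
  have hSS : Sᴴ * S = diagonal p ⊗ₖ diagonal q := by
    rw [hS, conjTranspose_kronecker, ← mul_kronecker_mul, hRβ, hLγ]
  have hTT : Tᴴ * T = diagonal r ⊗ₖ diagonal q := by
    rw [hT, conjTranspose_kronecker, ← mul_kronecker_mul, hLα, hRγ]
  have hUU : Uᴴ * U = diagonal r ⊗ₖ diagonal p := by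
    rw [hU, conjTranspose_kronecker, ← mul_kronecker_mul, hRα, hLβ]
  have hΨ' : ∀ i j k, Ψ (i, (j, k)) =
      ∑ x, ∑ y, ∑ z, S i (x, y) * T j (z, y) * U k (z, x) := by
    rintro ⟨i₁, i₂⟩ ⟨j₁, j₂⟩ ⟨k₁, k₂⟩
    rw [hΨ, hβ, hγ, hα, Finset.sum_mul_sum, Finset.sum_mul]
    refine Finset.sum_congr rfl fun x _ => ?_
    rw [Finset.sum_mul_sum]
    refine Finset.sum_congr rfl fun y _ => Finset.sum_congr rfl fun z _ => ?_
    simp only [hS, hT, hU, kronecker_apply]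
    ring
  simp only [dotProduct_kronecker_mulVec_eq S T U Ψ hΨ', Matrix.mul_one]
  refine (re_triangleContraction_le _ _ _).trans (Real.sqrt_le_sqrt ?_)
  rw [hSS, hTT, hUU, triangleContraction_diagonal_right _ p q r hr,
    triangleContraction_diagonal_middle _ p q r hp, triangleContraction_diagonal_left _ p q r hq,
    ← hSS, ← hTT, ← hUU]
  have hA := sum_norm_sq_conj_le hMA hMA1 S
  have hB := sum_norm_sq_conj_le hMB hMB1 T
  have hC := sum_norm_sq_conj_le hMC hMC1 U
  have hA0 := le_trans (by positivity) hA
  have hB0 := le_trans (by positivity) hB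
  gcongr
end
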